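/- For all positive integers n, Ord_{s_{123,132}}(Sₙ) = 2⌊(n−1)/2⌋: every π ∈ Sₙ satisfies that s_{123,132}^{2⌊(n−1)/2⌋}(π) is periodic under s_{123,132}, and there exists π ∈ Sₙ such that s_{123,132}^k(π) is not periodic for any k < 2⌊(n−1)/2⌋. -/

import Mathlib

open scoped Classical

/-- `π` is a permutation of `{1,…,n}` presented as a list. -/
def IsPermOf (n : ℕ) (π : List ℕ) : Prop :=
  π.Perm ((List.range n).map (· + 1))

/-- 1-indexed entry of a list. -/
def ent (π : List ℕ) (i : ℕ) : ℕ := π.getD (i - 1) 0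

/-- `a` and `b` are order-isomorphic (same length, same relative order). -/
def isoBool (a b : List ℕ) : Bool :=
  (a.length == b.length) &&
    (List.range a.length).all fun i =>
      (List.range a.length).all fun j =>
        !(decide (i < j)) ||
          (decide (a.getD i 0 < a.getD j 0) == decide (b.getD i 0 < b.getD j 0))

/-- `l` contains a subsequence order-isomorphic to the pattern `p`. -/
def containsPat (l p : List ℕ) : Bool :=
  l.sublists.any fun t => isoBool t p

/-- One full run of the right-greedy pattern-avoiding stack machine.
`T` is the list of forbidden patterns; the stack is read top-to-bottom
(head = top).  Push is preferred whenever the resulting stack avoids all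
patterns in `T`; otherwise the top of the stack is popped to the output.
At the end the stack is emptied onto the output. -/
def sortRun (T : List (List ℕ)) : List ℕ → List ℕ → List ℕ → List ℕ
  | [], stack, out => out ++ stack
  | x :: rest, stack, out =>
    if T.all (fun p => !containsPat (x :: stack) p) then
      sortRun T rest (x :: stack) out
    else
      match stack with
      | [] => sortRun T rest [x] out
      | y :: st => sortRun T (x :: rest) st (out ++ [y])
termination_by inp stack _ => 2 * inp.length + stack.length
decreasing_by all_goals (simp only [List.length_cons]; omega)

/-- The generalized stack-sorting map `s_T`. -/
def sortT (T : List (List ℕ)) (π : List ℕ) : List ℕ := sortRun T π [] []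

/-- The stack-sorting map `s_{123,132}`. -/
def s132 (π : List ℕ) : List ℕ := sortT [[1, 2, 3], [1, 3, 2]] π

/-- `π_i` is a left-to-right minimum of `π` (1-indexed). -/
def IsLtrMin (π : List ℕ) (i : ℕ) : Prop :=
  1 ≤ i ∧ i ≤ π.length ∧ ∀ m, 1 ≤ m → m ≤ i → ent π i ≤ ent π m

/-- `π_i` is a valley of `π`. -/
def IsValley (π : List ℕ) (i : ℕ) : Prop :=
  IsLtrMin π i ∧ (i + 1 ≤ π.length → ¬ IsLtrMin π (i + 1)) ∧
    (i + 2 ≤ π.length → IsLtrMin π (i + 2))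

/-- Positions `i, i+1, …, i+j` of `π` form a valley-block: `π_{i+j}` is a
valley and `π_i > ⋯ > π_{i+j}` are the `j+1` smallest entries among
`π_1,…,π_{i+j}`. -/
def IsValleyBlock (π : List ℕ) (i j : ℕ) : Prop :=
  1 ≤ i ∧ i + j ≤ π.length ∧ IsValley π (i + j) ∧
    (∀ k, i ≤ k → k < i + j → ent π (k + 1) < ent π k) ∧
    (∀ m, 1 ≤ m → m < i → ent π i < ent π m)

/-- Auxiliary (fuelled) predicate: the positions `i, i+1, …, π.length` of `π`
decompose as an alternation `v̄₁ a₁ v̄₂ a₂ ⋯ v̄_j a_j` of valley-blocks and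
single entries. -/
def AltFromAux (π : List ℕ) : ℕ → ℕ → Prop
  | 0, i => i = π.length + 1
  | fuel + 1, i => i = π.length + 1 ∨
      ∃ j, IsValleyBlock π i j ∧ AltFromAux π fuel (i + j + 2)

/-- The suffix of `π` starting at position `i` is a (nonempty) alternation of
valley-blocks and single entries. -/
def AltDecomp (π : List ℕ) (i : ℕ) : Prop :=
  i ≤ π.length ∧ AltFromAux π (π.length + 1) i

/-- The valley-boundary `𝔅(π)`: the smallest index `i` such that the suffix
`π_i,…,π_n` is an alternation of valley-blocks and single entries, and
`π.length` if no such index exists. -/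
noncomputable def vBoundary (π : List ℕ) : ℕ :=
  if _h : ∃ i, 1 ≤ i ∧ AltDecomp π i then sInf {i | 1 ≤ i ∧ AltDecomp π i}
  else π.length

/-- The value `x` appears in the valley-region `π_{𝔅(π)},…,π_n` of `π`. -/
def InValleyRegion (π : List ℕ) (x : ℕ) : Prop :=
  ∃ i, vBoundary π ≤ i ∧ i ≤ π.length ∧ ent π i = x

/-- `π` is half-decreasing: `π_{n-1}, π_{n-3}, …` (⌊(n−1)/2⌋ entries) is the
identity `1, 2, …, ⌊(n−1)/2⌋`. -/
def HalfDecreasing (π : List ℕ) : Prop :=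
  ∀ k, 1 ≤ k → k ≤ (π.length - 1) / 2 → ent π (π.length + 1 - 2 * k) = k

/-- `π` is periodic under `s_{123,132}`. -/
def PeriodicS (π : List ℕ) : Prop := ∃ k, 1 ≤ k ∧ s132^[k] π = π


/-- number of entries of the stack larger than `x` -/
def cnt (x : ℕ) (st : List ℕ) : ℕ := st.countP (fun y => decide (x < y))

/-- simplified stack machine -/
def runS : List ℕ → List ℕ → List ℕ
  | [], st => st
  | x :: r, st =>
    if cnt x st ≤ 1 then runS r (x :: st)
    else
      match st with
      | [] => runS r [x]
      | y :: st' => y :: runS (x :: r) st'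
termination_by inp st => 2 * inp.length + st.length
decreasing_by all_goals (simp only [List.length_cons]; omega)

def GoodSt : List ℕ → Prop
  | [] => True
  | x :: st => cnt x st ≤ 1 ∧ GoodSt st

theorem cnt_nil (x : ℕ) : cnt x [] = 0 := rfl

theorem cnt_cons (x y : ℕ) (l : List ℕ) : cnt x (y :: l) = cnt x l + if x < y then 1 else 0 := by
  unfold cnt; rw [List.countP_cons]; simp

theorem cnt_append (x : ℕ) (l l' : List ℕ) : cnt x (l ++ l') = cnt x l + cnt x l' := by
  unfold cnt; rw [List.countP_append]

theorem two_le_cnt (x : ℕ) (l : List ℕ) :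
    2 ≤ cnt x l ↔ ∃ b c, [b, c].Sublist l ∧ x < b ∧ x < c := by
  constructor
  · intro h
    unfold cnt at h
    rw [List.countP_eq_length_filter] at h
    have hs : (l.filter (fun y => decide (x < y))).Sublist l := List.filter_sublist
    have hm : ∀ y ∈ l.filter (fun y => decide (x < y)), x < y := by
      intro y hy
      simpa using (List.mem_filter.1 hy).2
    generalize l.filter (fun y => decide (x < y)) = f at *
    match f, h, hs, hm with
    | b :: c :: f', _, hs, hm =>
      refine ⟨b, c, ?_, hm b (by simp), hm c (by simp)⟩
      exact List.Sublist.trans (by simp) hs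
  · rintro ⟨b, c, hs, hb, hc⟩
    have h := hs.countP_le (p := fun y => decide (x < y))
    have h2 : ([b, c] : List ℕ).countP (fun y => decide (x < y)) = 2 := by
      simp [List.countP_cons, hb, hc]
    unfold cnt
    omega

theorem good_iff (l : List ℕ) :
    GoodSt l ↔ ¬ ∃ a b c, [a, b, c].Sublist l ∧ a < b ∧ a < c := by
  induction l with
  | nil => simp [GoodSt]
  | cons x l ih =>
    simp only [GoodSt]
    rw [ih]
    constructor
    · rintro ⟨h1, h2⟩ ⟨a, b, c, hs, hb, hc⟩
      rcases List.sublist_cons_iff.1 hs with h | ⟨r, hr, h⟩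
      · exact h2 ⟨a, b, c, h, hb, hc⟩
      · have hax : a = x := by simpa using (List.cons.inj hr).1
        have hrr : [b, c] = r := by simpa using (List.cons.inj hr).2
        subst hax
        subst hrr
        have := (two_le_cnt a l).2 ⟨b, c, h, hb, hc⟩
        omega
    · intro h
      constructor
      · by_contra hcon
        obtain ⟨b, c, hs, hb, hc⟩ := (two_le_cnt x l).1 (by omega)
        exact h ⟨x, b, c, hs.cons_cons x, hb, hc⟩
      · rintro ⟨a, b, c, hs, hb, hc⟩
        exact h ⟨a, b, c, hs.cons x, hb, hc⟩

theorem iso123 (t : List ℕ) : isoBool t [1, 2, 3] = true ↔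
    ∃ a b c, t = [a, b, c] ∧ a < b ∧ a < c ∧ b < c := by
  constructor
  · intro h
    have hl : t.length = 3 := by
      simp only [isoBool, Bool.and_eq_true, beq_iff_eq] at h
      simpa using h.1
    obtain ⟨a, b, c, rfl⟩ := List.length_eq_three.1 hl
    refine ⟨a, b, c, rfl, ?_⟩
    simp [isoBool, List.range_succ] at h
    tauto
  · rintro ⟨a, b, c, rfl, h1, h2, h3⟩
    simp [isoBool, List.range_succ, h1, h2, h3]

theorem iso132 (t : List ℕ) : isoBool t [1, 3, 2] = true ↔
    ∃ a b c, t = [a, b, c] ∧ a < b ∧ a < c ∧ ¬ b < c := by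
  constructor
  · intro h
    have hl : t.length = 3 := by
      simp only [isoBool, Bool.and_eq_true, beq_iff_eq] at h
      simpa using h.1
    obtain ⟨a, b, c, rfl⟩ := List.length_eq_three.1 hl
    refine ⟨a, b, c, rfl, ?_⟩
    simp [isoBool, List.range_succ] at h
    simp
    tauto
  · rintro ⟨a, b, c, rfl, h1, h2, h3⟩
    simp [isoBool, List.range_succ, h1, h2, not_lt.1 h3]

theorem chk_iff (l : List ℕ) :
    ([[1, 2, 3], [1, 3, 2]] : List (List ℕ)).all (fun p => !containsPat l p) = true ↔ GoodSt l := by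
  rw [good_iff]
  simp only [List.all_cons, List.all_nil, Bool.and_true, Bool.and_eq_true, Bool.not_eq_true',
    Bool.eq_false_iff, ne_eq, containsPat, List.any_eq_true, List.mem_sublists, iso123, iso132]
  constructor
  · rintro ⟨h1, h2⟩ ⟨a, b, c, hs, hb, hc⟩
    by_cases hbc : b < c
    · exact h1 ⟨_, hs, a, b, c, rfl, hb, hc, hbc⟩
    · exact h2 ⟨_, hs, a, b, c, rfl, hb, hc, hbc⟩
  · intro h
    constructor
    · rintro ⟨t, hs, a, b, c, rfl, hb, hc, hbc⟩
      exact h ⟨a, b, c, hs, hb, hc⟩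
    · rintro ⟨t, hs, a, b, c, rfl, hb, hc, hbc⟩
      exact h ⟨a, b, c, hs, hb, hc⟩

theorem sortRun_eq (inp st out : List ℕ) (hg : GoodSt st) :
    sortRun [[1, 2, 3], [1, 3, 2]] inp st out = out ++ runS inp st := by
  match inp, st with
  | [], st => rw [sortRun, runS]
  | x :: r, [] =>
    have hg' : GoodSt [x] := ⟨by simp [cnt], trivial⟩
    rw [sortRun, runS, if_pos ((chk_iff _).2 hg'), if_pos (by simp [cnt])]
    exact sortRun_eq r [x] out hg'
  | x :: r, y :: st' =>
    by_cases hc : cnt x (y :: st') ≤ 1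
    · have hg' : GoodSt (x :: y :: st') := ⟨hc, hg⟩
      rw [sortRun, runS, if_pos ((chk_iff _).2 hg'), if_pos hc]
      exact sortRun_eq r _ out hg'
    · have hg' : ¬ GoodSt (x :: y :: st') := fun h => hc h.1
      rw [sortRun, runS, if_neg (fun h => hg' ((chk_iff _).1 h)), if_neg hc]
      rw [sortRun_eq (x :: r) st' _ hg.2]
      simp
termination_by 2 * inp.length + st.length

theorem runS_nil (st : List ℕ) : runS [] st = st := by rw [runS.eq_def]

theorem runS_push {x : ℕ} {r st : List ℕ} (h : cnt x st ≤ 1) :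
    runS (x :: r) st = runS r (x :: st) := by
  rw [runS.eq_def]; simp only [if_pos h]

theorem runS_pop {x y : ℕ} {r st : List ℕ} (h : 2 ≤ cnt x (y :: st)) :
    runS (x :: r) (y :: st) = y :: runS (x :: r) st := by
  rw [runS, if_neg (by omega)]

theorem s132_nil : s132 [] = [] := by
  unfold s132 sortT
  rw [sortRun_eq _ [] _ trivial, runS_nil]; rfl

theorem s132_cons (x : ℕ) (u : List ℕ) : s132 (x :: u) = runS u [x] := by
  unfold s132 sortT
  rw [sortRun_eq _ [] _ trivial, runS_push (by simp [cnt])]; rfl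

theorem run_prefix (r base : List ℕ) (u : List ℕ) : ∀ st : List ℕ, (∀ y ∈ u, cnt y base ≤ 1) →
    ∃ σ st', (σ ++ st').Perm (u ++ st) ∧ runS (u ++ r) (st ++ base) = σ ++ runS r (st' ++ base) := by
  induction u with
  | nil => intro st _; exact ⟨[], st, by simp, by simp⟩
  | cons x u ih =>
    intro st h
    induction st with
    | nil =>
      obtain ⟨σ, st', hp, he⟩ := ih [x] (fun y hy => h y (by simp [hy]))
      refine ⟨σ, st', hp.trans ?_, ?_⟩
      · simp
      · rw [← he]
        exact runS_push (h x (by simp))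
    | cons y st ihs =>
      by_cases hc : cnt x (y :: st ++ base) ≤ 1
      · obtain ⟨σ, st', hp, he⟩ := ih (x :: y :: st) (fun y hy => h y (by simp [hy]))
        refine ⟨σ, st', hp.trans ?_, ?_⟩
        · exact List.perm_middle
        · rw [← he]
          exact runS_push hc
      · obtain ⟨σ, st', hp, he⟩ := ihs
        refine ⟨y :: σ, st', ?_, ?_⟩
        · refine (hp.cons y).trans ?_
          exact (List.perm_middle (l₁ := x :: u) (a := y) (l₂ := st)).symm
        · simp only [List.cons_append] at he ⊢
          rw [← he]
          exact runS_pop (by simp only [List.cons_append] at hc; omega)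

theorem run_pop (x : ℕ) (r base st : List ℕ) (h : ∀ y ∈ st, x < y) (hb : 1 ≤ cnt x base) :
    runS (x :: r) (st ++ base) = st ++ runS (x :: r) base := by
  induction st with
  | nil => rfl
  | cons y st ih =>
    simp only [List.cons_append]
    rw [runS_pop, ih (fun z hz => h z (by simp [hz]))]
    have := h y (by simp)
    rw [cnt_cons, cnt_append, if_pos this]
    omega

theorem run_all (base u : List ℕ) (h : ∀ y ∈ u, cnt y base ≤ 1) :
    ∃ σ, σ.Perm u ∧ runS u base = σ ++ base := by
  obtain ⟨σ, st', hp, he⟩ := run_prefix [] base u [] h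
  refine ⟨σ ++ st', by simpa using hp, ?_⟩
  simpa [runS_nil] using he

theorem cnt_one (y m : ℕ) : cnt y [m] ≤ 1 := by
  rw [cnt_cons, cnt_nil]; split <;> omega

theorem cnt_two {y c m : ℕ} (h : c ≤ y) : cnt y [c, m] ≤ 1 := by
  rw [cnt_cons, cnt_cons, cnt_nil, if_neg (by omega : ¬ y < c)]; split <;> omega

theorem run_C2 (m x : ℕ) (u r : List ℕ) (hm : x < m) (hu : ∀ y ∈ u, x < y) :
    ∃ σ, σ.Perm u ∧ runS (u ++ x :: r) [m] = σ ++ runS r [x, m] := by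
  obtain ⟨σ, st', hp, he⟩ := run_prefix (x :: r) [m] u [] (fun y _ => cnt_one y m)
  refine ⟨σ ++ st', by simpa using hp, ?_⟩
  have hst : ∀ y ∈ st', x < y := by
    intro y hy
    apply hu
    have := hp.subset (List.mem_append_right σ hy)
    simpa using this
  rw [run_pop x r [m] st' hst (by simp [cnt_cons, hm]), runS_push (cnt_one x m)] at he
  simpa using he

theorem run_C3 (m c x : ℕ) (u r : List ℕ) (hm : c < m) (hx : x < c) (hu : ∀ y ∈ u, c ≤ y) :
    ∃ σ, σ.Perm u ∧ runS (u ++ x :: r) [c, m] = σ ++ c :: runS r [x, m] := by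
  obtain ⟨σ, st', hp, he⟩ := run_prefix (x :: r) [c, m] u [] (fun y hy => cnt_two (hu y hy))
  refine ⟨σ ++ st', by simpa using hp, ?_⟩
  have hst : ∀ y ∈ st', x < y := by
    intro y hy
    apply lt_of_lt_of_le hx
    apply hu
    have := hp.subset (List.mem_append_right σ hy)
    simpa using this
  have hxm : x < m := hx.trans hm
  rw [run_pop x r [c, m] st' hst (by simp [cnt_cons, hx, hxm]), runS_pop (by simp [cnt_cons, hx, hxm]),
    runS_push (cnt_one x m)] at he
  simpa using he

theorem s132_perm (l : List ℕ) : (s132 l).Perm l := by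
  cases l with
  | nil => rw [s132_nil]
  | cons x u =>
    obtain ⟨σ, hp, he⟩ := run_all [x] u (fun y _ => cnt_one y x)
    rw [s132_cons, he]
    exact (hp.append_right [x]).trans (List.perm_append_singleton x u)

/-- After a left-to-right minimum `v`, the remainder has no two consecutive non-minima. -/
inductive RegV : ℕ → List ℕ → Prop
  | nil (v : ℕ) : RegV v []
  | one (v a : ℕ) : v < a → RegV v [a]
  | vv (v x : ℕ) (w : List ℕ) : x < v → RegV x w → RegV v (x :: w)
  | va (v a x : ℕ) (w : List ℕ) : v < a → x < v → RegV x w → RegV v (a :: x :: w)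

theorem RegV.len {v : ℕ} {w : List ℕ} (h : RegV v w) (hv : 1 ≤ v) (hw : ∀ y ∈ w, 1 ≤ y) :
    w.length + 1 ≤ 2 * v := by
  induction h with
  | nil v => simp; omega
  | one v a _ => simp; omega
  | vv v x w h1 h2 ih =>
    have := ih (hw x (by simp)) (fun y hy => hw y (by simp [hy]))
    simp; omega
  | va v a x w h1 h2 h3 ih =>
    have := ih (hw x (by simp)) (fun y hy => hw y (by simp [hy]))
    simp; omega

theorem run_vv {v x m : ℕ} (w : List ℕ) (h : x < v) (hm : v < m) :
    runS (x :: w) [v, m] = v :: runS w [x, m] := by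
  have hxm : x < m := h.trans hm
  rw [runS_pop (by simp [cnt_cons, h, hxm]), runS_push (cnt_one x m)]

theorem run_va {v a x m : ℕ} (w : List ℕ) (ha : v < a) (h : x < v) (hm : v < m) :
    runS (a :: x :: w) [v, m] = a :: v :: runS w [x, m] := by
  have hxm : x < m := h.trans hm
  have hxa : x < a := h.trans ha
  rw [runS_push (cnt_two ha.le), runS_pop (by simp [cnt_cons, h, hxa, hxm]), run_vv w h hm]

theorem run_a {v a m : ℕ} (ha : v < a) : runS [a] [v, m] = [a, v, m] := by
  rw [runS_push (cnt_two ha.le), runS_nil]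

/-- Shape of the output on a valley region. -/
def OutShape (v : ℕ) (w O : List ℕ) : Prop :=
  ∃ O', RegV v O' ∧ (O = v :: O' ∨ ∃ a ∈ w, v < a ∧ O = a :: v :: O')

theorem OutShape.reg {v c : ℕ} {w O : List ℕ} (h : OutShape v w O) (hc : v < c) (hcw : c ∉ w) :
    RegV c O := by
  obtain ⟨O', hr, rfl | ⟨a, ha, hva, rfl⟩⟩ := h
  · exact RegV.vv _ _ _ hc hr
  · have hne : a ≠ c := fun h => hcw (h ▸ ha)
    rcases lt_or_gt_of_ne hne with h | h
    · exact RegV.vv _ _ _ h (RegV.vv _ _ _ hva hr)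
    · exact RegV.va _ _ _ _ h hc hr

theorem out_shape {v : ℕ} {w : List ℕ} (m : ℕ) (h : RegV v w) (hm : v < m) (hn : (v :: w).Nodup) :
    OutShape v w (runS w [v, m]) := by
  induction h with
  | nil v => exact ⟨[m], RegV.one _ _ hm, Or.inl (by rw [runS_nil])⟩
  | one v a ha => exact ⟨[m], RegV.one _ _ hm, Or.inr ⟨a, by simp, ha, run_a ha⟩⟩
  | vv v x w h1 h2 ih =>
    have hs := ih (h1.trans hm) (List.nodup_cons.1 hn).2
    have hvw : v ∉ w := fun h => (List.nodup_cons.1 hn).1 (by simp [h])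
    exact ⟨_, hs.reg h1 hvw, Or.inl (run_vv w h1 hm)⟩
  | va v a x w h1 h2 h3 ih =>
    have hs := ih (h2.trans hm) (List.nodup_cons.1 (List.nodup_cons.1 hn).2).2
    have hvw : v ∉ w := fun h => (List.nodup_cons.1 hn).1 (by simp [h])
    exact ⟨_, hs.reg h2 hvw, Or.inr ⟨a, by simp, h1, run_va w h1 h2 hm⟩⟩

/-- The valley region contains all values `≤ K` and is not everything. -/
def VInv (K : ℕ) (π : List ℕ) : Prop :=
  ∃ u v w, π = u ++ v :: w ∧ u ≠ [] ∧ (∀ y ∈ u, v < y) ∧ RegV v w ∧ (∀ y ∈ u, K < y)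

theorem inv_full {K x : ℕ} {l : List ℕ} (h : RegV x l) (hx : 1 ≤ x) (hl : ∀ y ∈ l, 1 ≤ y)
    (hK : 1 ≤ K) (hlen : 2 * K + 1 ≤ (x :: l).length) : VInv K (x :: l) := by
  have hb := h.len hx hl
  have hKx : K < x := by simp at hlen; omega
  cases h with
  | nil => simp at hlen; omega
  | one a => simp at hlen; omega
  | vv _ y w h1 h2 => exact ⟨[x], y, w, rfl, by simp, by simp [h1], h2, by simp [hKx]⟩
  | va _ a y w h1 h2 h3 =>
    exact ⟨[x, a], y, w, rfl, by simp, by simp; omega, h3, by simp; omega⟩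

theorem exists_min (l : List ℕ) (h : l ≠ []) : ∃ c ∈ l, ∀ y ∈ l, c ≤ y := by
  induction l with
  | nil => exact absurd rfl h
  | cons x l ih =>
    by_cases hl : l = []
    · subst hl; exact ⟨x, by simp, by simp⟩
    · obtain ⟨c, hc, hm⟩ := ih hl
      rcases le_total x c with h | h
      · exact ⟨x, by simp, by simpa using fun y hy => h.trans (hm y hy)⟩
      · exact ⟨c, by simp [hc], by simpa using ⟨h, hm⟩⟩

theorem inv_step {j K : ℕ} {π : List ℕ} (hn : π.Nodup) (hp : ∀ y ∈ π, 1 ≤ y) (hI : VInv j π)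
    (hKj : K ≤ j + 1) (hK : 1 ≤ K) (hlen : 2 * K + 1 ≤ π.length) : VInv K (s132 π) := by
  have hperm := s132_perm π
  have hn' : (s132 π).Nodup := hperm.nodup_iff.2 hn
  have hp' : ∀ y ∈ s132 π, 1 ≤ y := fun y hy => hp y (hperm.subset hy)
  have hlen' : 2 * K + 1 ≤ (s132 π).length := by rw [hperm.length_eq]; exact hlen
  obtain ⟨u, v, w, rfl, hu, hvu, hr, hju⟩ := hI
  obtain ⟨m, u', rfl⟩ : ∃ m u', u = m :: u' := List.exists_cons_of_ne_nil hu
  have hvm : v < m := hvu m (by simp)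
  have hjm : j < m := hju m (by simp)
  have hnvw : (v :: w).Nodup := (List.nodup_append.1 hn).2.1
  have hmu : ∀ y ∈ m :: u', y ∉ v :: w := by
    intro y hy hy2
    exact (List.nodup_append.1 hn).2.2 y hy y hy2 rfl
  have hnu : (m :: u').Nodup := (List.nodup_append.1 hn).1
  have hshape := out_shape m hr hvm hnvw
  by_cases hc : ∃ c ∈ u', c < m
  · obtain ⟨c0, hc0, hc0m⟩ := hc
    obtain ⟨c, hcu, hcmin⟩ := exists_min u' (List.ne_nil_of_mem hc0)
    have hcm : c < m := lt_of_le_of_lt (hcmin c0 hc0) hc0m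
    obtain ⟨u1, u2, rfl⟩ := List.append_of_mem hcu
    have hnc : c ∉ u1 ++ u2 := by
      have := (List.nodup_cons.1 hnu).2
      exact (List.nodup_middle.1 this |> List.nodup_cons.1).1
    have hlt : ∀ y ∈ u1 ++ u2, c < y := by
      intro y hy
      refine lt_of_le_of_ne (hcmin y ?_) (fun h => hnc (h ▸ hy))
      simp at hy ⊢; tauto
    have hvc : v < c := hvu c (by simp)
    have hjc : j < c := hju c (by simp)
    obtain ⟨σ1, hp1, he1⟩ := run_C2 m c u1 (u2 ++ v :: w) hcm (fun y hy => hlt y (by simp [hy]))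
    obtain ⟨σ2, hp2, he2⟩ := run_C3 m c v u2 w hcm hvc (fun y hy => (hlt y (by simp [hy])).le)
    have hs : s132 (m :: (u1 ++ c :: u2) ++ v :: w) = (σ1 ++ σ2) ++ c :: runS w [v, m] := by
      rw [List.cons_append, s132_cons]
      have : u1 ++ c :: u2 ++ v :: w = u1 ++ c :: (u2 ++ v :: w) := by simp
      rw [this, he1, he2]; simp
    have hreg : RegV c (runS w [v, m]) :=
      hshape.reg hvc (fun h => hmu c (by simp) (by simp [h]))
    have hσ : ∀ y ∈ σ1 ++ σ2, c < y := fun y hy => hlt y ((hp1.append hp2).subset hy)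
    rw [hs] at hlen' hp' ⊢
    by_cases hnil : σ1 ++ σ2 = []
    · rw [hnil] at hlen' hp' ⊢
      simp only [List.nil_append] at hlen' hp' ⊢
      exact inv_full hreg (hp' c (by simp)) (fun y hy => hp' y (by simp [hy])) hK hlen'
    · exact ⟨_, c, _, rfl, hnil, hσ, hreg, fun y hy => by have := hσ y hy; omega⟩
  · push Not at hc
    have hlt : ∀ y ∈ u', m < y := by
      intro y hy
      refine lt_of_le_of_ne (hc y hy) (fun h => (List.nodup_cons.1 hnu).1 (h ▸ hy))
    obtain ⟨σ, hpσ, he⟩ := run_C2 m v u' w hvm (fun y hy => hvu y (by simp [hy]))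
    have hs : s132 (m :: u' ++ v :: w) = σ ++ runS w [v, m] := by
      rw [List.cons_append, s132_cons, he]
    have hσ : ∀ y ∈ σ, m < y := fun y hy => hlt y (hpσ.subset hy)
    have hσv : ∀ y ∈ σ, v < y := fun y hy => hvm.trans (hσ y hy)
    have hσK : ∀ y ∈ σ, K < y := fun y hy => by have := hσ y hy; omega
    rw [hs] at hlen' hp' hn' ⊢
    obtain ⟨O', hO', hO | ⟨a, ha, hva, hO⟩⟩ := hshape
    · rw [hO] at hlen' hp' hn' ⊢
      by_cases hnil : σ = []
      · subst hnil
        simp only [List.nil_append] at hlen' hp' ⊢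
        exact inv_full hO' (hp' v (by simp)) (fun y hy => hp' y (by simp [hy])) hK hlen'
      · exact ⟨_, v, _, rfl, hnil, hσv, hO', hσK⟩
    · rw [hO] at hlen' hp' hn' ⊢
      have hra : RegV a (v :: O') := RegV.vv _ _ _ hva hO'
      by_cases hnil : σ = []
      · subst hnil
        simp only [List.nil_append] at hlen' hp' ⊢
        exact inv_full hra (hp' a (by simp)) (fun y hy => hp' y (by simp [hy])) hK hlen'
      · by_cases hall : ∀ y ∈ σ, a < y
        · exact ⟨_, a, _, rfl, hnil, hall, hra, hσK⟩
        · push Not at hall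
          obtain ⟨y, hy, hya⟩ := hall
          have hyK := hσK y hy
          refine ⟨σ ++ [a], v, O', by simp, by simp, ?_, hO', ?_⟩
          · intro z hz
            rcases List.mem_append.1 hz with h | h
            · exact hσv z h
            · simp at h; omega
          · intro z hz
            rcases List.mem_append.1 hz with h | h
            · exact hσK z h
            · simp at h; omega

theorem inv_base {π : List ℕ} (hn : π.Nodup) (hp : ∀ y ∈ π, 1 ≤ y) (h1 : 1 ∈ π)
    (hlen : 3 ≤ π.length) : VInv 1 (s132 π) := by
  have hgt : ∀ {a b : List ℕ}, s132 π = a ++ 1 :: b → ∀ y ∈ a, 1 < y := by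
    intro a b he y hy
    have hperm := s132_perm π
    have hn' : (s132 π).Nodup := hperm.nodup_iff.2 hn
    have h1y : 1 ≤ y := hp y (hperm.subset (by rw [he]; simp [hy]))
    rw [he] at hn'
    have := (List.nodup_append.1 hn').2.2 y hy 1 (by simp)
    omega
  cases π with
  | nil => simp at hlen
  | cons m u =>
    simp at hlen
    by_cases hm : m = 1
    · subst hm
      obtain ⟨σ, hpσ, he⟩ := run_all [1] u (fun y _ => cnt_one y 1)
      rw [← s132_cons] at he
      have hl := hpσ.length_eq
      refine ⟨σ, 1, [], he, ?_, hgt he, RegV.nil _, hgt he⟩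
      rintro rfl
      simp at hl; omega
    · have hu : 1 ∈ u := by simp at h1; tauto
      have hm1 : 1 < m := by have := hp m (by simp); omega
      obtain ⟨u1, u2, rfl⟩ := List.append_of_mem hu
      have hu1 : ∀ y ∈ u1, 1 < y := by
        intro y hy
        have h1y : 1 ≤ y := hp y (by simp [hy])
        have hn2 := (List.nodup_cons.1 hn).2
        have := (List.nodup_append.1 hn2).2.2 y hy 1 (by simp)
        omega
      obtain ⟨σ, hpσ, he⟩ := run_C2 m 1 u1 u2 hm1 hu1
      obtain ⟨τ, hpτ, he2⟩ := run_all [1, m] u2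
        (fun y hy => cnt_two (hp y (by simp [hy])))
      rw [← s132_cons, he2] at he
      have he' : s132 (m :: (u1 ++ 1 :: u2)) = (σ ++ τ) ++ 1 :: [m] := by rw [he]; simp
      refine ⟨σ ++ τ, 1, [m], he', ?_, hgt he', RegV.one _ _ hm1, hgt he'⟩
      intro h
      have := (hpσ.append hpτ).length_eq
      rw [h] at this
      simp at this hlen
      omega

/-- nonfirst left-to-right minimum -/
def LM (k : ℕ) (π : List ℕ) (q : List ℕ) : Prop :=
  ∃ m p, π = m :: p ++ k :: q ∧ ∀ y ∈ m :: p, k < y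

/-- isolated non-minimum -/
def SA (k : ℕ) (π : List ℕ) (q : List ℕ) : Prop :=
  ∃ m p c, π = m :: p ++ c :: k :: q ∧ (∀ y ∈ m :: p, c < y) ∧ c < k ∧
    (q = [] ∨ ∃ x q', q = x :: q' ∧ x < c)

theorem reg_cases {v : ℕ} {w : List ℕ} (h : RegV v w) (k : ℕ) : ∀ (m : ℕ) (u : List ℕ),
    (∀ y ∈ m :: u, v < y) → k ∈ v :: w →
    ∃ q, LM k (m :: u ++ v :: w) q ∨ SA k (m :: u ++ v :: w) q := by
  induction h with
  | nil v =>
    intro m u hu hk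
    simp at hk; subst hk
    exact ⟨[], Or.inl ⟨m, u, rfl, hu⟩⟩
  | one v a ha =>
    intro m u hu hk
    simp at hk
    rcases hk with rfl | rfl
    · exact ⟨_, Or.inl ⟨m, u, rfl, hu⟩⟩
    · exact ⟨[], Or.inr ⟨m, u, v, rfl, hu, ha, Or.inl rfl⟩⟩
  | vv v x w h1 h2 ih =>
    intro m u hu hk
    rcases List.mem_cons.1 hk with rfl | hk
    · exact ⟨_, Or.inl ⟨m, u, rfl, hu⟩⟩
    · have := ih m (u ++ [v]) (by
        intro y hy
        simp only [List.mem_cons, List.mem_append, List.not_mem_nil, or_false] at hy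
        rcases hy with rfl | hy | rfl
        · exact h1.trans (hu _ (by simp))
        · exact h1.trans (hu y (by simp [hy]))
        · exact h1) hk
      simpa using this
  | va v a x w h1 h2 h3 ih =>
    intro m u hu hk
    rcases List.mem_cons.1 hk with rfl | hk
    · exact ⟨_, Or.inl ⟨m, u, rfl, hu⟩⟩
    · rcases List.mem_cons.1 hk with rfl | hk
      · exact ⟨x :: w, Or.inr ⟨m, u, v, rfl, hu, h1, Or.inr ⟨x, w, rfl, h2⟩⟩⟩
      · have := ih m (u ++ [v, a]) (by
          intro y hy
          simp only [List.mem_cons, List.mem_append, List.not_mem_nil, or_false] at hy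
          rcases hy with rfl | hy | rfl | rfl
          · exact h2.trans (hu _ (by simp))
          · exact h2.trans (hu y (by simp [hy]))
          · exact h2
          · exact h2.trans h1) hk
        simpa using this

theorem inv_cases {K k : ℕ} {π : List ℕ} (hI : VInv K π) (hk : k ≤ K) (hkπ : k ∈ π) :
    ∃ q, LM k π q ∨ SA k π q := by
  obtain ⟨u, v, w, rfl, hu, hvu, hr, hK⟩ := hI
  obtain ⟨m, u', rfl⟩ : ∃ m u', u = m :: u' := List.exists_cons_of_ne_nil hu
  refine reg_cases hr k m u' hvu ?_
  rcases List.mem_append.1 hkπ with h | h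
  · have := hK k h; omega
  · exact h

theorem split_lt (c : ℕ) (q : List ℕ) : (∀ y ∈ q, c ≤ y) ∨
    ∃ q1 x q2, q = q1 ++ x :: q2 ∧ x < c ∧ ∀ y ∈ q1, c ≤ y := by
  induction q with
  | nil => left; simp
  | cons a q ih =>
    by_cases ha : a < c
    · exact Or.inr ⟨[], a, q, rfl, ha, by simp⟩
    · rcases ih with h | ⟨q1, x, q2, rfl, hx, h⟩
      · left; intro y hy
        rcases List.mem_cons.1 hy with rfl | hy
        · omega
        · exact h y hy
      · refine Or.inr ⟨a :: q1, x, q2, rfl, hx, ?_⟩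
        intro y hy
        rcases List.mem_cons.1 hy with rfl | hy
        · omega
        · exact h y hy

theorem LM_step {k : ℕ} {π q : List ℕ} (hn : π.Nodup) (h : LM k π q) :
    ∃ p' q', s132 π = p' ++ k :: q' ∧ (∀ y ∈ p', k < y) ∧ q'.length ≤ q.length + 1 := by
  obtain ⟨m, p, rfl, hp⟩ := h
  have hkq : k ∉ q := (List.nodup_cons.1 (List.nodup_append.1 hn).2.1).1
  obtain ⟨σ, hpσ, he⟩ := run_C2 m k p q (hp m (by simp)) (fun y hy => hp y (by simp [hy]))
  have hs : s132 (m :: p ++ k :: q) = σ ++ runS q [k, m] := by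
    rw [List.cons_append, s132_cons, he]
  have hσ : ∀ y ∈ σ, k < y := fun y hy => hp y (by simp [hpσ.subset hy])
  have hl := (s132_perm (m :: p ++ k :: q)).length_eq
  have hlσ := hpσ.length_eq
  have key : ∃ τ q', runS q [k, m] = τ ++ k :: q' ∧ ∀ y ∈ τ, k < y := by
    rcases split_lt k q with h | ⟨q1, x, q2, rfl, hx, h⟩
    · obtain ⟨τ, hpτ, he⟩ := run_all [k, m] q (fun y hy => cnt_two (h y hy))
      refine ⟨τ, [m], he, fun y hy => ?_⟩
      have hyq := hpτ.subset hy
      exact lt_of_le_of_ne (h y hyq) (fun e => hkq (e ▸ hyq))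
    · obtain ⟨τ, hpτ, he⟩ := run_C3 m k x q1 q2 (hp m (by simp)) hx h
      refine ⟨τ, _, he, fun y hy => ?_⟩
      have hyq := hpτ.subset hy
      exact lt_of_le_of_ne (h y hyq) (fun e => hkq (by rw [e]; simp [hyq]))
  obtain ⟨τ, q', hτ, hlt⟩ := key
  rw [hs, hτ] at hl
  refine ⟨σ ++ τ, q', by rw [hs, hτ]; simp, ?_, ?_⟩
  · intro y hy
    rcases List.mem_append.1 hy with h | h
    · exact hσ y h
    · exact hlt y h
  · simp at hl; omega

theorem SA_step {k : ℕ} {π q : List ℕ} (h : SA k π q) :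
    ∃ p' q', s132 π = p' ++ k :: q' ∧ q'.length = q.length + 2 := by
  obtain ⟨m, p, c, rfl, hp, hck, hq⟩ := h
  have hcm := hp m (by simp)
  obtain ⟨σ, hpσ, he⟩ := run_C2 m c p (k :: q) hcm (fun y hy => hp y (by simp [hy]))
  have hs : s132 (m :: p ++ c :: k :: q) = σ ++ runS (k :: q) [c, m] := by
    rw [List.cons_append, s132_cons, he]
  have hl := (s132_perm (m :: p ++ c :: k :: q)).length_eq
  have hlσ := hpσ.length_eq
  rcases hq with rfl | ⟨x, q', rfl, hx⟩
  · rw [run_a hck] at hs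
    exact ⟨σ, [c, m], hs, by simp⟩
  · rw [run_va q' hck hx hcm] at hs
    refine ⟨σ, _, hs, ?_⟩
    rw [hs] at hl
    simp at hl ⊢; omega

/-- the tail `k a_k (k-1) a_{k-1} ⋯ 1 a_1` -/
def Wl : List ℕ → List ℕ
  | [] => []
  | a :: as => (as.length + 1) :: a :: Wl as

def HD (k : ℕ) (π : List ℕ) : Prop :=
  ∃ ρ as, π = ρ ++ Wl as ∧ ρ ≠ [] ∧ as.length = k ∧ (∀ y ∈ ρ, k < y) ∧ (∀ y ∈ as, k < y)

theorem Wl_length (as : List ℕ) : (Wl as).length = 2 * as.length := by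
  induction as with
  | nil => rfl
  | cons a as ih => simp [Wl, ih]; ring

theorem run_W (as : List ℕ) : ∀ a x : ℕ, as.length + 1 < a → as.length + 1 < x →
    (∀ y ∈ as, as.length + 1 < y) →
    runS (a :: Wl as) [as.length + 1, x] = a :: Wl (as ++ [x]) := by
  induction as with
  | nil =>
    intro a x ha hx _
    simp [Wl]
    exact run_a ha
  | cons b bs ih =>
    intro a x ha hx h
    simp only [List.length_cons] at ha hx h ⊢
    have hb := h b (by simp)
    rw [Wl, run_va _ ha (by omega) hx, ih b x (by omega) (by omega)
      (fun y hy => by have := h y (by simp [hy]); omega)]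
    simp [Wl]

/-- One step on a half-decreasing list. -/
theorem s132_W (x : ℕ) (ρ as : List ℕ) (h : ∀ y ∈ x :: ρ, as.length < y)
    (ha : ∀ y ∈ as, as.length < y) :
    ∃ σ, σ.Perm ρ ∧ s132 (x :: ρ ++ Wl as) =
      match as with
      | [] => σ ++ [x]
      | a :: as' => σ ++ a :: Wl (as' ++ [x]) := by
  cases as with
  | nil =>
    obtain ⟨σ, hp, he⟩ := run_all [x] ρ (fun y _ => cnt_one y x)
    refine ⟨σ, hp, ?_⟩
    simp only [Wl, List.append_nil]
    rw [s132_cons, he]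
  | cons a as =>
    simp only [List.length_cons] at h ha
    obtain ⟨σ, hp, he⟩ := run_C2 x (as.length + 1) ρ (a :: Wl as) (h x (by simp))
      (fun y hy => h y (by simp [hy]))
    refine ⟨σ, hp, ?_⟩
    simp only [Wl]
    rw [List.cons_append, s132_cons, he, run_W as a x (ha a (by simp)) (h x (by simp))
      (fun y hy => ha y (by simp [hy]))]

theorem HD_step {k : ℕ} {π : List ℕ} (h : HD k π) : HD k (s132 π) := by
  obtain ⟨ρ, as, rfl, hρ, hlen, h1, h2⟩ := h
  obtain ⟨x, ρ', rfl⟩ : ∃ m u', ρ = m :: u' := List.exists_cons_of_ne_nil hρ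
  subst hlen
  obtain ⟨σ, hp, he⟩ := s132_W x ρ' as h1 h2
  have hσ : ∀ y ∈ σ, as.length < y := fun y hy => h1 y (by simp [hp.subset hy])
  have hx := h1 x (by simp)
  cases as with
  | nil =>
    refine ⟨σ ++ [x], [], by simpa [Wl] using he, by simp, rfl, ?_, by simp⟩
    intro y hy
    rcases List.mem_append.1 hy with h | h
    · exact hσ y h
    · simp at h; subst h; exact hx
  | cons a as =>
    refine ⟨σ ++ [a], as ++ [x], by simpa using he, by simp, by simp, ?_, ?_⟩
    · intro y hy
      rcases List.mem_append.1 hy with h | h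
      · exact hσ y h
      · simp at h; subst h; exact h2 _ (by simp)
    · intro y hy
      rcases List.mem_append.1 hy with h | h
      · exact h2 y (by simp [h])
      · simp at h; subst h; exact hx

/-- Raising the level. -/
theorem HD_raise {k x : ℕ} {ρ1 ρ2 as : List ℕ}
    (hn : (x :: ρ1 ++ (k + 1) :: ρ2 ++ Wl as).Nodup)
    (hlen : as.length = k) (h1 : ∀ y ∈ x :: ρ1 ++ (k + 1) :: ρ2, k < y) (h2 : ∀ y ∈ as, k < y)
    (h2' : k + 1 ∉ as)
    (hl : 2 * k + 3 ≤ (x :: ρ1 ++ (k + 1) :: ρ2 ++ Wl as).length) :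
    HD (k + 1) (s132 (x :: ρ1 ++ (k + 1) :: ρ2 ++ Wl as)) := by
  have hnρ := (List.nodup_append.1 hn).1
  have hk : k + 1 ∉ x :: ρ1 ++ ρ2 := (List.nodup_cons.1 (List.nodup_middle.1 hnρ)).1
  have h3 : ∀ y ∈ x :: ρ1 ++ ρ2, k + 1 < y := by
    intro y hy
    have : k < y := h1 y (by simp at hy ⊢; tauto)
    have : y ≠ k + 1 := fun h => hk (h ▸ hy)
    omega
  have h4 : ∀ y ∈ as, k + 1 < y := by
    intro y hy
    have : k < y := h2 y hy
    have : y ≠ k + 1 := fun h => h2' (h ▸ hy)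
    omega
  have hx : k + 1 < x := h3 x (by simp)
  obtain ⟨σ, hp, he⟩ := run_C2 x (k + 1) ρ1 (ρ2 ++ Wl as) hx (fun y hy => h3 y (by simp [hy]))
  have hs : s132 (x :: ρ1 ++ (k + 1) :: ρ2 ++ Wl as) = σ ++ runS (ρ2 ++ Wl as) [k + 1, x] := by
    rw [← he, ← s132_cons]; simp
  have key : ∃ τ, τ.Perm ρ2 ∧ runS (ρ2 ++ Wl as) [k + 1, x] = τ ++ Wl (as ++ [x]) := by
    cases as with
    | nil =>
      simp at hlen; subst hlen
      obtain ⟨τ, hpτ, heτ⟩ := run_all [0 + 1, x] ρ2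
        (fun y hy => cnt_two (h3 y (by simp [hy])).le)
      exact ⟨τ, hpτ, by simpa [Wl] using heτ⟩
    | cons a as =>
      simp at hlen; subst hlen
      obtain ⟨τ, hpτ, heτ⟩ := run_C3 x (as.length + 1 + 1) (as.length + 1) ρ2 (a :: Wl as) hx
        (by omega) (fun y hy => (h3 y (by simp [hy])).le)
      refine ⟨τ, hpτ, ?_⟩
      rw [Wl, heτ, run_W as a x (by have := h4 a (by simp); omega) (by omega)
        (fun y hy => by have := h4 y (by simp [hy]); omega)]
      simp [Wl]
  obtain ⟨τ, hpτ, heτ⟩ := key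
  rw [hs, heτ]
  have hle := (hp.append hpτ)
  refine ⟨σ ++ τ, as ++ [x], by simp, ?_, by simp [hlen], ?_, ?_⟩
  · intro h
    have := hle.length_eq
    rw [h] at this
    simp [Wl_length] at this hl
    omega
  · intro y hy
    have := hle.subset hy
    exact h3 y (by simp at this ⊢; tauto)
  · intro y hy
    rcases List.mem_append.1 hy with h | h
    · exact h4 y h
    · simp at h; omega

theorem perm_nodup {n : ℕ} {l : List ℕ} (h : IsPermOf n l) : l.Nodup := by
  refine h.nodup_iff.2 ?_
  exact List.nodup_range.map (fun a b h => by simpa using h)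

theorem perm_mem {n : ℕ} {l : List ℕ} (h : IsPermOf n l) (y : ℕ) : y ∈ l ↔ 1 ≤ y ∧ y ≤ n := by
  rw [List.Perm.mem_iff h]
  simp only [List.mem_map, List.mem_range]
  constructor
  · rintro ⟨a, ha, rfl⟩; omega
  · rintro ⟨h1, h2⟩; exact ⟨y - 1, by omega, by omega⟩

theorem perm_len {n : ℕ} {l : List ℕ} (h : IsPermOf n l) : l.length = n := by
  rw [List.Perm.length_eq h]; simp

theorem perm_s {n : ℕ} {l : List ℕ} (h : IsPermOf n l) : IsPermOf n (s132 l) :=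
  (s132_perm l).trans h

theorem perm_iter {n : ℕ} {l : List ℕ} (h : IsPermOf n l) (t : ℕ) : IsPermOf n (s132^[t] l) := by
  induction t with
  | zero => exact h
  | succ t ih => rw [Function.iterate_succ_apply']; exact perm_s ih

theorem orbit_inv {n : ℕ} {l : List ℕ} (h : IsPermOf n l) (hm : 1 ≤ (n - 1) / 2) (t : ℕ) :
    VInv (min (t + 1) ((n - 1) / 2)) (s132^[t + 1] l) := by
  induction t with
  | zero =>
    have : min (0 + 1) ((n - 1) / 2) = 1 := by omega
    rw [this]
    exact inv_base (perm_nodup h) (fun y hy => ((perm_mem h y).1 hy).1)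
      ((perm_mem h 1).2 (by omega)) (by rw [perm_len h]; omega)
  | succ t ih =>
    have hp := perm_iter h (t + 1)
    rw [Function.iterate_succ_apply']
    exact inv_step (perm_nodup hp) (fun y hy => ((perm_mem hp y).1 hy).1) ih (by omega) (by omega)
      (by rw [perm_len hp]; omega)

theorem orbit_inv' {n : ℕ} {l : List ℕ} (h : IsPermOf n l) {k t : ℕ} (hk : 1 ≤ k)
    (hkm : k ≤ (n - 1) / 2) (ht : k ≤ t) : ∃ K, k ≤ K ∧ VInv K (s132^[t] l) := by
  obtain ⟨t', rfl⟩ : ∃ t', t = t' + 1 := ⟨t - 1, by omega⟩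
  exact ⟨_, by omega, orbit_inv h (by omega) t'⟩

theorem not_first {K k : ℕ} {q : List ℕ} (h : VInv K (k :: q)) (hk : k ≤ K) : False := by
  obtain ⟨u, v, w, he, hu, hvu, hr, hK⟩ := h
  obtain ⟨m, u', rfl⟩ : ∃ m u', u = m :: u' := List.exists_cons_of_ne_nil hu
  have : k = m := by simpa using (List.cons.inj he).1
  have := hK m (by simp)
  omega

theorem split_unique {k : ℕ} : ∀ (p p2 q q2 : List ℕ), (p ++ k :: q).Nodup →
    p ++ k :: q = p2 ++ k :: q2 → q = q2 := by
  intro p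
  induction p with
  | nil =>
    intro p2 q q2 hn he
    cases p2 with
    | nil => simpa using he
    | cons a p2 =>
      simp only [List.nil_append, List.cons_append, List.cons.injEq] at he
      obtain ⟨rfl, rfl⟩ := he
      simp at hn
  | cons b p ih =>
    intro p2 q q2 hn he
    cases p2 with
    | nil =>
      simp only [List.nil_append, List.cons_append, List.cons.injEq] at he
      obtain ⟨rfl, rfl⟩ := he
      simp at hn
    | cons a p2 =>
      simp only [List.cons_append, List.cons.injEq] at he
      exact ih p2 q q2 (List.nodup_cons.1 hn).2 he.2

theorem claimC {n : ℕ} {l : List ℕ} (h : IsPermOf n l) {k : ℕ} (hk : 1 ≤ k)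
    (hkm : k ≤ (n - 1) / 2) (j : ℕ) :
    (∃ q, LM k (s132^[k + j] l) q) ∨ ∃ p q, s132^[k + j] l = p ++ k :: q ∧ 2 * j ≤ q.length := by
  induction j with
  | zero =>
    obtain ⟨K, hK, hI⟩ := orbit_inv' h hk hkm (show k ≤ k + 0 by omega)
    have hp := perm_iter h (k + 0)
    obtain ⟨q, hq | ⟨m, p, c, he, _⟩⟩ := inv_cases hI hK ((perm_mem hp k).2 (by omega))
    · exact Or.inl ⟨q, hq⟩
    · exact Or.inr ⟨m :: p ++ [c], q, by rw [he]; simp, by simp⟩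
  | succ j ih =>
    obtain ⟨K, hK, hI⟩ := orbit_inv' h hk hkm (show k ≤ k + j by omega)
    obtain ⟨K', hK', hI'⟩ := orbit_inv' h hk hkm (show k ≤ k + (j + 1) by omega)
    have hp := perm_iter h (k + j)
    have hLM : ∀ q, LM k (s132^[k + j] l) q → ∃ q, LM k (s132^[k + (j + 1)] l) q := by
      intro q hq
      obtain ⟨p', q', he, hlt, _⟩ := LM_step (perm_nodup hp) hq
      rw [← Function.iterate_succ_apply' s132] at he
      cases p' with
      | nil =>
        exfalso
        have he' : s132^[k + (j + 1)] l = k :: q' := he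
        rw [he'] at hI'
        exact not_first hI' hK'
      | cons m p' => exact ⟨q', m, p', he, hlt⟩
    rcases ih with ⟨q, hq⟩ | ⟨p, q, he, hlen⟩
    · exact Or.inl (hLM q hq)
    · obtain ⟨q2, hq2 | hq2⟩ := inv_cases hI hK ((perm_mem hp k).2 (by omega))
      · exact Or.inl (hLM q2 hq2)
      · obtain ⟨p', q', he', hl'⟩ := SA_step hq2
        obtain ⟨m, p2, c, he2, _⟩ := hq2
        have hn := perm_nodup hp
        have : q = q2 := by
          rw [he] at hn he2
          exact split_unique p (m :: p2 ++ [c]) q q2 hn (by rw [he2]; simp)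
        subst this
        rw [← Function.iterate_succ_apply' s132] at he'
        exact Or.inr ⟨p', q', he', by omega⟩

theorem main_HD {n : ℕ} (hn1 : 1 ≤ n) {l : List ℕ} (h : IsPermOf n l) (k : ℕ)
    (hkm : k ≤ (n - 1) / 2) : HD k (s132^[2 * k] l) := by
  induction k with
  | zero =>
    refine ⟨l, [], by simp [Wl], ?_, rfl, fun y hy => ((perm_mem h y).1 hy).1, by simp⟩
    rintro rfl
    have := perm_len h
    simp at this; omega
  | succ k ih =>
    have hH := ih (by omega)
    -- raising when `k+1` is in the front part
    have raise : ∀ t ρ as, k + 1 ≤ t → s132^[t] l = ρ ++ Wl as → as.length = k →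
        (∀ y ∈ ρ, k < y) → (∀ y ∈ as, k < y) → k + 1 ∈ ρ → k + 1 ∉ as →
        HD (k + 1) (s132^[t + 1] l) := by
      intro t ρ as ht he hlen h1 h2 hρ has
      have hp := perm_iter h t
      obtain ⟨K, hK, hI⟩ := orbit_inv' h (show 1 ≤ k + 1 by omega) hkm ht
      obtain ⟨ρ1, ρ2, rfl⟩ := List.append_of_mem hρ
      rw [Function.iterate_succ_apply']
      have hnd := perm_nodup hp
      have hpl := perm_len hp
      rw [he] at hI hnd hpl ⊢
      cases ρ1 with
      | nil => exact (not_first hI hK).elim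
      | cons x ρ1 =>
        exact HD_raise hnd hlen h1 h2 has (by rw [hpl]; omega)
    rcases Nat.eq_zero_or_pos k with hk0 | hk0
    · subst hk0
      have hp := perm_iter h 1
      refine raise 1 (s132^[1] l) [] le_rfl (by simp [Wl]) rfl
        (fun y hy => ((perm_mem hp y).1 hy).1) (by simp) ((perm_mem hp _).2 (by omega)) (by simp)
    · obtain ⟨ρ, as, he, hρ, hlen, h1, h2⟩ := hH
      have hp := perm_iter h (2 * k)
      have hnd := perm_nodup hp
      have hpl := perm_len hp
      have hmem := (perm_mem hp (k + 1)).2 (by omega)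
      cases as with
      | nil => simp at hlen; omega
      | cons a as' =>
        have hmem' := hmem
        rw [he] at hmem' hpl
        have hnd' := hnd
        rw [he] at hnd'
        have hsub : ∀ as : List ℕ, as.Sublist (Wl as) := by
          intro as
          induction as with
          | nil => simp [Wl]
          | cons b bs ihb => exact (ihb.cons_cons b).cons _
        by_cases hin : k + 1 ∈ ρ
        · have hnot : k + 1 ∉ a :: as' := by
            intro hc
            exact (List.nodup_append.1 hnd').2.2 _ hin _ ((hsub _).subset hc) rfl
          have := HD_step (raise (2 * k) ρ (a :: as') (by omega) he hlen h1 h2 hin hnot)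
          rw [← Function.iterate_succ_apply' s132] at this
          exact this
        · have hw : k + 1 ∈ Wl (a :: as') := by
            rcases List.mem_append.1 hmem' with h | h
            · exact absurd h hin
            · exact h
          simp only [List.length_cons] at hlen
          have hak : a = k + 1 := by
            by_contra hne
            have hw' : k + 1 ∈ Wl as' := by
              simp only [Wl, List.mem_cons] at hw
              rcases hw with h | h | h
              · omega
              · exact absurd h.symm hne
              · exact h
            obtain ⟨w1, w2, hw12⟩ := List.append_of_mem hw'
            have hC := claimC h (show 1 ≤ k + 1 by omega) hkm (k - 1)
            have h2k : k + 1 + (k - 1) = 2 * k := by omega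
            rw [h2k] at hC
            have heq : s132^[2 * k] l = (ρ ++ [k, a] ++ w1) ++ (k + 1) :: w2 := by
              rw [he]; simp [Wl, hw12, hlen]
            have hl2 := Wl_length as'
            rw [hw12] at hl2
            simp at hl2
            rcases hC with ⟨q, m, p, hq, hlt⟩ | ⟨p, q, hq, hlq⟩
            · have hmid : ∀ (P Q P' Q' : List ℕ), (P ++ (k + 1) :: Q).Nodup →
                  P ++ (k + 1) :: Q = P' ++ (k + 1) :: Q' → P = P' := by
                intro P Q P' Q' hN hE
                have := split_unique P P' Q Q' hN hE
                subst this
                exact List.append_cancel_right hE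
              rw [heq] at hnd hq
              have hPP := hmid _ _ _ _ hnd hq
              have := hlt k (by rw [← hPP]; simp)
              omega
            · rw [heq] at hnd hq
              have := split_unique _ _ _ _ hnd hq
              subst this
              omega
          subst hak
          obtain ⟨x, ρ', rfl⟩ : ∃ m u', ρ = m :: u' := List.exists_cons_of_ne_nil hρ
          obtain ⟨σ, hpσ, hs⟩ := s132_W x ρ' ((k + 1) :: as') (by simpa [hlen] using h1)
            (by simpa [hlen] using h2)
          simp only at hs
          have hp1 := perm_iter h (2 * k + 1)
          have hit : s132^[2 * k + 1] l = (σ ++ [k + 1]) ++ Wl (as' ++ [x]) := by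
            rw [Function.iterate_succ_apply', he, hs]; simp
          have hnd1 := perm_nodup hp1
          rw [hit] at hnd1
          refine raise (2 * k + 1) _ _ (by omega) hit (by simp [hlen]) ?_ ?_ (by simp) ?_
          · intro y hy
            rcases List.mem_append.1 hy with h | h
            · exact h1 y (by simp [hpσ.subset h])
            · simp at h; omega
          · intro y hy
            rcases List.mem_append.1 hy with h | h
            · exact h2 y (by simp [h])
            · simp at h; subst h; exact h1 _ (by simp)
          · intro hc
            exact (List.nodup_append.1 hnd1).2.2 (k + 1) (by simp) _ ((hsub _).subset hc) rfl

theorem HD_iter {k : ℕ} {l : List ℕ} (h : HD k l) (t : ℕ) : HD k (s132^[t] l) := by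
  induction t with
  | zero => exact h
  | succ t ih => rw [Function.iterate_succ_apply']; exact HD_step ih

def FW (r : ℕ) (L : List ℕ) : List ℕ := L.take r ++ Wl (L.drop r)

theorem FW_step (r : ℕ) (hr : r = 1 ∨ r = 2) (L : List ℕ) (hL : r ≤ L.length)
    (h : ∀ y ∈ L, L.length - r < y) : s132 (FW r L) = FW r (L.rotate 1) := by
  rcases hr with rfl | rfl
  · match L, hL, h with
    | x :: as, _, h =>
      simp only [List.length_cons, Nat.add_sub_cancel] at h
      obtain ⟨σ, hp, he⟩ := s132_W x [] as (fun y hy => h y (by simp at hy; simp [hy]))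
        (fun y hy => h y (by simp [hy]))
      have hσ : σ = [] := hp.eq_nil
      subst hσ
      rw [List.rotate_cons_succ, List.rotate_zero]
      have hF : FW 1 (x :: as) = [x] ++ Wl as := by simp [FW]
      rw [hF, he]
      cases as <;> simp [FW, Wl]
  · match L, hL, h with
    | x :: z :: as, _, h =>
      simp only [List.length_cons] at h
      have h' : ∀ y ∈ x :: z :: as, as.length < y := fun y hy => by have := h y hy; omega
      obtain ⟨σ, hp, he⟩ := s132_W x [z] as (fun y hy => h' y (by simp at hy ⊢; tauto))
        (fun y hy => h' y (by simp [hy]))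
      have hσ : σ = [z] := List.perm_singleton.1 hp
      subst hσ
      rw [List.rotate_cons_succ, List.rotate_zero]
      have hF : FW 2 (x :: z :: as) = [x, z] ++ Wl as := by simp [FW]
      rw [hF, he]
      cases as <;> simp [FW, Wl]

theorem FW_iter (r : ℕ) (hr : r = 1 ∨ r = 2) (L : List ℕ) (hL : r ≤ L.length)
    (h : ∀ y ∈ L, L.length - r < y) (t : ℕ) : s132^[t] (FW r L) = FW r (L.rotate t) := by
  induction t with
  | zero => simp
  | succ t ih =>
    rw [Function.iterate_succ_apply', ih, FW_step r hr _ (by simpa using hL), List.rotate_rotate]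
    intro y hy
    rw [List.length_rotate]
    exact h y (List.mem_rotate.1 hy)

theorem HD_periodic {n : ℕ} (hn : 1 ≤ n) {l : List ℕ} (hl : l.length = n)
    (h : HD ((n - 1) / 2) l) : PeriodicS l := by
  obtain ⟨ρ, as, rfl, hρ, hlen, h1, h2⟩ := h
  have hw := Wl_length as
  rw [List.length_append] at hl
  have hpos : 1 ≤ ρ.length := List.length_pos_iff.2 hρ
  have hF : FW ρ.length (ρ ++ as) = ρ ++ Wl as := by simp [FW]
  refine ⟨(ρ ++ as).length, by simp; omega, ?_⟩
  rw [← hF, FW_iter ρ.length (by omega) _ (by simp), List.rotate_length]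
  intro y hy
  rw [List.length_append, Nat.add_sub_cancel_left, hlen]
  rcases List.mem_append.1 hy with h | h
  · exact h1 y h
  · exact h2 y h

theorem periodic_HD {n : ℕ} (hn : 1 ≤ n) {l : List ℕ} (hl : IsPermOf n l) (h : PeriodicS l) :
    HD ((n - 1) / 2) l := by
  obtain ⟨p, hp, he⟩ := h
  have hfix : ∀ c, s132^[p * c] l = l := by
    intro c
    rw [Function.iterate_mul]
    exact Function.iterate_fixed he c
  have h1 := HD_iter (main_HD hn hl _ le_rfl) (p * (2 * ((n - 1) / 2)) - 2 * ((n - 1) / 2))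
  rw [← Function.iterate_add_apply, Nat.sub_add_cancel (Nat.le_mul_of_pos_left _ hp), hfix] at h1
  exact h1

theorem periodic_fwd {l : List ℕ} (h : PeriodicS l) (t : ℕ) : PeriodicS (s132^[t] l) := by
  obtain ⟨p, hp, he⟩ := h
  refine ⟨p, hp, ?_⟩
  rw [← Function.iterate_add_apply, add_comm, Function.iterate_add_apply, he]

theorem dec_run (a p : ℕ) (r : List ℕ) (len : ℕ) (h : a + len + 1 < p) :
    runS ((List.range' (a + 1) len).reverse ++ a :: r) [a + len + 1, p] =
      (List.range' (a + 1) (len + 1)).reverse ++ runS r [a, p] := by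
  induction len with
  | zero =>
    simp
    exact run_vv r (by omega) (by omega)
  | succ len ih =>
    rw [List.range'_1_concat, List.reverse_append, List.range'_1_concat (n := len + 1),
      List.reverse_append]
    simp only [List.reverse_singleton, List.nil_append, List.cons_append]
    rw [run_vv _ (by omega) h]
    have e1 : a + 1 + len = a + len + 1 := by omega
    have e2 : a + 1 + (len + 1) = a + (len + 1) + 1 := by omega
    rw [e1, ih (by omega), e2]

theorem dec_step (a len : ℕ) (r : List ℕ) : ∃ r',
    s132 ((List.range' a (len + 3)).reverse ++ r) = (List.range' (a + 1) (len + 1)).reverse ++ r' := by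
  refine ⟨runS r [a, a + len + 2], ?_⟩
  have e : (List.range' a (len + 3)).reverse ++ r =
      (a + len + 2) :: (a + len + 1) :: ((List.range' (a + 1) len).reverse ++ a :: r) := by
    rw [List.range'_succ, List.range'_1_concat, List.range'_1_concat]
    simp
    omega
  rw [e, s132_cons, runS_push (cnt_one _ _), dec_run _ _ _ _ (by omega)]

theorem dec_iter (M : ℕ) : ∀ (a : ℕ) (r : List ℕ), ∃ r',
    s132^[M] ((List.range' a (2 * M + 1)).reverse ++ r) = (a + M) :: r' := by
  induction M with
  | zero => intro a r; exact ⟨r, by simp⟩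
  | succ M ih =>
    intro a r
    obtain ⟨r1, h1⟩ := dec_step a (2 * M) r
    obtain ⟨r2, h2⟩ := ih (a + 1) r1
    refine ⟨r2, ?_⟩
    rw [Function.iterate_succ_apply]
    have : 2 * (M + 1) + 1 = 2 * M + 3 := by ring
    rw [this, h1, h2]
    congr 1; omega

theorem upper_off {n : ℕ} {l r : List ℕ} (h : IsPermOf n l) {k : ℕ} (hk : 1 ≤ k)
    (hkm : k ≤ (n - 1) / 2) (hf : s132^[k - 1] l = k :: r) (j : ℕ) :
    ∃ p q, s132^[k + j] l = p ++ k :: q ∧ q.length ≤ 2 * j := by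
  induction j with
  | zero =>
    obtain ⟨σ, _, he⟩ := run_all [k] r (fun y _ => cnt_one y k)
    refine ⟨σ, [], ?_, by simp⟩
    have : k + 0 = (k - 1) + 1 := by omega
    rw [this, Function.iterate_succ_apply', hf, s132_cons, he]
  | succ j ih =>
    obtain ⟨p, q, he, hq⟩ := ih
    obtain ⟨K, hK, hI⟩ := orbit_inv' h hk hkm (show k ≤ k + j by omega)
    have hp := perm_iter h (k + j)
    have hn := perm_nodup hp
    have e : s132^[k + (j + 1)] l = s132 (s132^[k + j] l) := Function.iterate_succ_apply' s132 _ _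
    obtain ⟨q2, hq2 | hq2⟩ := inv_cases hI hK ((perm_mem hp k).2 (by omega))
    · obtain ⟨p', q', he', _, hl'⟩ := LM_step hn hq2
      obtain ⟨m, p2, he2, _⟩ := hq2
      have : q = q2 := by
        rw [he] at hn he2
        exact split_unique p (m :: p2) q q2 hn he2
      subst this
      exact ⟨p', q', by rw [e, he'], by omega⟩
    · obtain ⟨p', q', he', hl'⟩ := SA_step hq2
      obtain ⟨m, p2, c, he2, _⟩ := hq2
      have : q = q2 := by
        rw [he] at hn he2
        exact split_unique p (m :: p2 ++ [c]) q q2 hn (by rw [he2]; simp)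
      subst this
      exact ⟨p', q', by rw [e, he'], by omega⟩

theorem lower {n : ℕ} (hn : 1 ≤ n) : ∃ π : List ℕ, IsPermOf n π ∧
      ∀ k, k < 2 * ((n - 1) / 2) → ¬ PeriodicS (s132^[k] π) := by
  rcases Nat.eq_zero_or_pos ((n - 1) / 2) with h0 | h0
  · exact ⟨_, List.Perm.refl _, fun k hk => by omega⟩
  · obtain ⟨M, hM⟩ : ∃ M, (n - 1) / 2 = M + 1 := ⟨(n - 1) / 2 - 1, by omega⟩
    set π := (List.range' 1 (2 * M + 1)).reverse ++ List.range' (1 + (2 * M + 1)) (n - (2 * M + 1))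
      with hπ
    have hperm : IsPermOf n π := by
      unfold IsPermOf
      have e : (List.range n).map (· + 1) = List.range' 1 n := by
        rw [List.range'_eq_map_range]
        apply List.map_congr_left
        intro a _
        omega
      rw [e]
      refine ((List.reverse_perm _).append_right _).trans ?_
      have := List.range'_append_1 (s := 1) (m := 2 * M + 1) (n := n - (2 * M + 1))
      rw [this, show 2 * M + 1 + (n - (2 * M + 1)) = n by omega]
    refine ⟨π, hperm, ?_⟩
    intro k hk hper
    obtain ⟨r, hr⟩ := dec_iter M 1 (List.range' (1 + (2 * M + 1)) (n - (2 * M + 1)))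
    obtain ⟨p, q, he, hq⟩ := upper_off hperm (k := M + 1) (by omega) (by omega) (r := r)
      (by rw [Nat.add_sub_cancel, hπ, hr, add_comm]) M
    have hper2 := periodic_fwd hper (M + 1 + M - k)
    rw [← Function.iterate_add_apply, Nat.sub_add_cancel (by omega)] at hper2
    have hp2 := perm_iter hperm (M + 1 + M)
    have hHD := periodic_HD hn hp2 hper2
    rw [hM] at hHD
    obtain ⟨ρ, as, heq, hρ, hlen, h1, h2⟩ := hHD
    have hnd := perm_nodup hp2
    cases as with
    | nil => simp at hlen
    | cons a as =>
      simp only [List.length_cons] at hlen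
      rw [Wl, hlen] at heq
      rw [he] at hnd heq
      have hqq := split_unique _ _ _ _ hnd heq
      have hl := Wl_length as
      rw [hqq] at hq
      simp at hq
      omega

/-- `Ord_{s_{123,132}}(Sₙ) = 2⌊(n-1)/2⌋`: every `π ∈ Sₙ`
becomes periodic after `2⌊(n-1)/2⌋` iterations, and some `π ∈ Sₙ` is not
periodic after any smaller number of iterations. -/
theorem stmt14 (n : ℕ) (hn : 1 ≤ n) :
    (∀ π : List ℕ, IsPermOf n π → PeriodicS (s132^[2 * ((n - 1) / 2)] π)) ∧
    (∃ π : List ℕ, IsPermOf n π ∧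
      ∀ k, k < 2 * ((n - 1) / 2) → ¬ PeriodicS (s132^[k] π)) := by
  refine ⟨fun π hπ => ?_, lower hn⟩
  exact HD_periodic hn (perm_len (perm_iter hπ _)) (main_HD hn hπ _ le_rfl)
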